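/- Let G be a group, F ≤ G a subgroup, and (X,π) a uniformly convex isometric Banach G-module which, as an FC_G(F)-module (by restriction of π), has no almost invariant unit vectors. Then for every n ≥ 0 the restriction map H^n(G,X) → H^n(F,X) is zero; equivalently, for every φ ∈ Z^n(G,X) the restriction φ|_{Fⁿ} lies in B^n(F,X). -/

import Mathlib

noncomputable section

open scoped BigOperators

variable {G : Type*} [Group G] {X : Type*} [NormedAddCommGroup X] [NormedSpace ℝ X]

/-- `FC_G(F)`: the set of elements of `G` with finite `F`-conjugacy class. -/
def FCset (F : Subgroup G) : Set G :=
  {g | Set.Finite {x | ∃ f ∈ F, x = f * g * f⁻¹}}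

/-- Almost invariant unit vectors for the restriction of the action to a subset `S ⊆ G`. -/
def HasAIUVOn (π : G →* (X →L[ℝ] X)) (S : Set G) : Prop :=
  ∀ E : Finset G, (E : Set G) ⊆ S → ∀ ε : ℝ, 0 < ε →
    ∃ x : X, ‖x‖ = 1 ∧ ∀ g ∈ E, ‖x - π g x‖ < ε

/-- The coboundary operator `∂^{n+1} : Cⁿ(G,X) → C^{n+1}(G,X)` of the standard
inhomogeneous cochain complex (with the sign conventions of the paper). -/
def cochainD (π : G →* (X →L[ℝ] X)) (n : ℕ) (φ : (Fin n → G) → X) :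
    (Fin (n + 1) → G) → X :=
  fun g =>
    -(π (g 0) (φ fun i => g i.succ)) + ((-1 : ℝ) ^ n) • φ (fun i => g i.castSucc)
      - ∑ k : Fin n, ((-1 : ℝ) ^ ((k : ℕ) + 1)) •
          φ (fun j => if (j : ℕ) < (k : ℕ) then g j.castSucc
            else if (j : ℕ) = (k : ℕ) then g k.castSucc * g k.succ
            else g j.succ)

/-- The space `Zⁿ(G,X) = ker ∂^{n+1}` of `n`-cocycles. -/
def Zset (π : G →* (X →L[ℝ] X)) (n : ℕ) : Set ((Fin n → G) → X) :=
  {φ | cochainD π n φ = 0}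

/-- The space `Bⁿ(G,X) = range ∂ⁿ` of `n`-coboundaries (`B⁰ = {0}`). -/
def Bset (π : G →* (X →L[ℝ] X)) : ∀ n : ℕ, Set ((Fin n → G) → X)
  | 0 => {0}
  | n + 1 => Set.range (cochainD π n)

/-- Restriction of an `n`-cochain on `G` to a subgroup `F`. -/
def resC (F : Subgroup G) (n : ℕ) (φ : (Fin n → G) → X) : (Fin n → F) → X :=
  fun f => φ fun i => (f i : G)

/-- The simplicial (homogeneous) coboundary `∑ᵢ (-1)ⁱ Φ(x₀, …, x̂ᵢ, …, xₙ)`. -/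
def homogD {α : Type*} (n : ℕ) (Φ : (Fin n → α) → X) (x : Fin (n + 1) → α) : X :=
  ∑ i : Fin (n + 1), ((-1 : ℝ) ^ (i : ℕ)) • Φ (fun j => x (i.succAbove j))

/-- The homogeneous cochain attached to an inhomogeneous one. -/
def homogenize (π : G →* (X →L[ℝ] X)) (n : ℕ) (φ : (Fin n → G) → X) (x : Fin (n + 1) → G) : X :=
  π (x 0) (φ fun i => (x i.castSucc)⁻¹ * x i.succ)

/-- The prism operator `∑ᵢ (-1)ⁱ Φ(x₀, …, xᵢ, g xᵢ, …, g xₙ)`. -/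
def prism {M : Type*} [AddCommGroup M] (g : G) :
    ∀ n : ℕ, ((Fin (n + 1) → G) → M) → (Fin n → G) → M
  | 0, _, _ => 0
  | n + 1, Φ, x =>
      Φ (Fin.cons (x 0) (Fin.cons (g * x 0) fun i => g * x i.succ))
        - prism g n (fun y => Φ (Fin.cons (x 0) y)) (fun i => x i.succ)

lemma homogD_succ {α : Type*} (n : ℕ) (Φ : (Fin (n + 1) → α) → X) (x : Fin (n + 2) → α) :
    homogD (n + 1) Φ x = Φ (fun i => x i.succ)
      - homogD n (fun y => Φ (Fin.cons (x 0) y)) (fun i => x i.succ) := by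
  have key (i : Fin (n + 1)) : (fun j => x (i.succ.succAbove j))
      = Fin.cons (x 0) (fun j => x (i.succAbove j).succ) := by
    funext j
    refine Fin.cases ?_ (fun j => ?_) j <;> simp
  simp [homogD, Fin.sum_univ_succ (n := n + 1), key, pow_succ, sub_eq_add_neg]

lemma homogD_sub {α : Type*} (n : ℕ) (Φ Ψ : (Fin n → α) → X) (x : Fin (n + 1) → α) :
    homogD n (fun y => Φ y - Ψ y) x = homogD n Φ x - homogD n Ψ x := by
  simp [homogD, smul_sub]

lemma homogD_sum {α ι : Type*} (s : Finset ι) (n : ℕ) (Φ : ι → (Fin n → α) → X)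
    (x : Fin (n + 1) → α) :
    homogD n (fun y => ∑ k ∈ s, Φ k y) x = ∑ k ∈ s, homogD n (Φ k) x := by
  simp only [homogD, Finset.smul_sum]
  exact Finset.sum_comm

lemma prism_sub {M : Type*} [AddCommGroup M] (g : G) (n : ℕ) (Φ Ψ : (Fin (n + 1) → G) → M)
    (x : Fin n → G) :
    prism g n (fun y => Φ y - Ψ y) x = prism g n Φ x - prism g n Ψ x := by
  induction n with
  | zero => simp [prism]
  | succ n ih => simp only [prism, ih]; abel

lemma prism_zero {M : Type*} [AddCommGroup M] (g : G) (n : ℕ) (x : Fin n → G) :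
    prism g n (fun _ => (0 : M)) x = 0 := by
  simpa using prism_sub g n (fun _ => (0 : M)) (fun _ => 0) x

lemma prism_map (g : G) (T : X →L[ℝ] X) (n : ℕ) (Φ : (Fin (n + 1) → G) → X) (x : Fin n → G) :
    prism g n (fun y => T (Φ y)) x = T (prism g n Φ x) := by
  induction n with
  | zero => simp [prism]
  | succ n ih => simp only [prism, ih, map_sub]

lemma prism_translate {M : Type*} [AddCommGroup M] (g f : G) (n : ℕ) (Φ : (Fin (n + 1) → G) → M)
    (x : Fin n → G) :
    prism g n Φ (fun i => f * x i)
      = prism (f⁻¹ * g * f) n (fun y => Φ fun i => f * y i) x := by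
  induction n with
  | zero => simp [prism]
  | succ n ih =>
    have h1 (a : G) (k : ℕ) (y : Fin k → G) :
        (fun i => f * (Fin.cons a y : Fin (k + 1) → G) i)
          = Fin.cons (f * a) (fun i => f * y i) := by
      funext j
      refine Fin.cases ?_ (fun j => ?_) j <;> simp
    simp only [prism, ih, h1]
    simp [mul_assoc]

/-- The prism operator is a homotopy between the identity and left translation by `g`. -/
lemma homogD_prism_add_prism_homogD (g : G) (n : ℕ) (Φ : (Fin (n + 1) → G) → X)
    (x : Fin (n + 1) → G) :
    homogD n (prism g n Φ) x + prism g (n + 1) (homogD (n + 1) Φ) x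
      = Φ (fun i => g * x i) - Φ x := by
  induction n with
  | zero =>
    have h0 : (fun j : Fin 1 => (Fin.cons (x 0) (Fin.cons (g * x 0) fun i => g * x i.succ) :
        Fin 2 → G) ((0 : Fin 2).succAbove j)) = fun i => g * x i := by
      funext i
      fin_cases i
      rfl
    have h1 : (fun j : Fin 1 => (Fin.cons (x 0) (Fin.cons (g * x 0) fun i => g * x i.succ) :
        Fin 2 → G) ((1 : Fin 2).succAbove j)) = x := by
      funext i
      fin_cases i
      rfl
    simp only [homogD, prism, smul_zero, Finset.sum_const_zero, zero_add, sub_zero]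
    rw [Fin.sum_univ_two, h0, h1]
    simp [sub_eq_add_neg]
  | succ n ih =>
    have hx : Fin.cons (x 0) (fun i => x i.succ) = x := Fin.cons_self_tail x
    have hgx : Fin.cons (g * x 0) (fun i => g * x i.succ) = fun i => g * x i := by
      funext j
      refine Fin.cases ?_ (fun j => ?_) j <;> simp
    have ih' := ih (fun y => Φ (Fin.cons (x 0) y)) (fun i => x i.succ)
    have hT (k : ℕ) (Ψ : (Fin k → G) → X) (y : Fin (k + 1) → G) :
        homogD k (fun z => Ψ fun i => g * z i) y = homogD k Ψ (fun i => g * y i) := rfl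
    have hP : prism g (n + 2) (homogD (n + 2) Φ) x
        = Φ (fun i => g * x i) - Φ (Fin.cons (x 0) fun i => g * x i.succ)
          + homogD n (fun y => Φ (Fin.cons (x 0) (Fin.cons (g * x 0) y)))
              (fun i => g * x i.succ)
          - (prism g (n + 1) Φ (fun i => x i.succ)
            - prism g (n + 1) (homogD (n + 1) fun y => Φ (Fin.cons (x 0) y))
                (fun i => x i.succ)) := by
      rw [← prism_sub, prism, homogD_succ, homogD_succ]
      simp only [homogD_succ (n + 1), Fin.cons_zero, Fin.cons_succ, hgx]
      abel
    have hD : homogD (n + 1) (prism g (n + 1) Φ) x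
        = prism g (n + 1) Φ (fun i => x i.succ)
          - (homogD n (fun y => Φ (Fin.cons (x 0) (Fin.cons (g * x 0) y)))
              (fun i => g * x i.succ)
            - homogD n (prism g n fun y => Φ (Fin.cons (x 0) y)) (fun i => x i.succ)) := by
      rw [homogD_succ, ← hT, ← homogD_sub]
      simp only [prism, Fin.cons_zero, Fin.cons_succ]
    rw [hP, hD]
    simp only [hx] at ih'
    rw [← sub_eq_zero] at ih' ⊢
    rw [← ih']
    abel

lemma homogD_homogenize (π : G →* (X →L[ℝ] X)) (n : ℕ) (φ : (Fin n → G) → X)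
    (x : Fin (n + 2) → G) :
    homogD (n + 1) (homogenize π n φ) x = -homogenize π (n + 1) (cochainD π n φ) x := by
  have hmid (k : Fin n) :
      (fun j : Fin n => (x (k.castSucc.succ.succAbove j.castSucc))⁻¹ *
          x (k.castSucc.succ.succAbove j.succ))
        = fun j : Fin n =>
          if (j : ℕ) < (k : ℕ) then (x j.castSucc.castSucc)⁻¹ * x j.castSucc.succ
          else if (j : ℕ) = (k : ℕ) then
            ((x k.castSucc.castSucc)⁻¹ * x k.castSucc.succ) *
              ((x k.succ.castSucc)⁻¹ * x k.succ.succ)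
          else (x j.succ.castSucc)⁻¹ * x j.succ.succ := by
    funext j
    rcases lt_trichotomy (j : ℕ) (k : ℕ) with h | h | h
    · rw [if_pos h, Fin.succAbove_of_castSucc_lt, Fin.succAbove_of_castSucc_lt]
      · rfl
      all_goals simp only [Fin.lt_def, Fin.val_castSucc, Fin.val_succ]; omega
    · obtain rfl := Fin.ext h
      rw [if_neg (lt_irrefl _), if_pos rfl, Fin.succAbove_of_castSucc_lt,
        Fin.succAbove_of_le_castSucc]
      · rw [← Fin.succ_castSucc]
        group
      all_goals simp only [Fin.lt_def, Fin.le_def, Fin.val_castSucc, Fin.val_succ]; omega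
    · rw [if_neg h.not_gt, if_neg h.ne', Fin.succAbove_of_le_castSucc,
        Fin.succAbove_of_le_castSucc]
      · rfl
      all_goals simp only [Fin.le_def, Fin.val_castSucc, Fin.val_succ]; omega
  have hlast (j : Fin (n + 1)) : (Fin.last (n + 1)).succAbove j = j.castSucc :=
    Fin.succAbove_last_apply j
  rw [homogD, Fin.sum_univ_succ, Fin.sum_univ_castSucc]
  simp only [homogenize, cochainD, hmid, Fin.succ_last, hlast, Fin.succ_succAbove_zero,
    Fin.zero_succAbove, Fin.castSucc_zero, map_sub, map_add, map_neg, map_sum, map_smul, map_mul,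
    Fin.val_zero, Fin.val_succ, Fin.val_castSucc, Fin.val_last, pow_zero, one_smul]
  have hπ (y : X) : π (x 0) ((π (x 0)⁻¹ * π (x (Fin.succ 0))) y) = π (x (Fin.succ 0)) y := by
    rw [← map_mul, ← mul_apply_eq_comp, ← map_mul, mul_inv_cancel_left]
  simp only [hπ, Fin.succ_castSucc, Nat.succ_eq_add_one, pow_succ, mul_neg_one, neg_smul]
  abel

lemma homogenize_partialProd (π : G →* (X →L[ℝ] X)) (n : ℕ) (φ : (Fin n → G) → X)
    (f : Fin n → G) : homogenize π n φ (Fin.partialProd f) = φ f := by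
  simp [homogenize, Fin.partialProd_right_inv]

/-- An equivariant homogeneous cochain comes from its inhomogeneous version. -/
lemma homogenize_of_equivariant (π : G →* (X →L[ℝ] X)) (n : ℕ) (Ψ : (Fin (n + 1) → G) → X)
    (hΨ : ∀ (g : G) (x : Fin (n + 1) → G), Ψ (fun i => g * x i) = π g (Ψ x)) :
    homogenize π n (fun f => Ψ (Fin.partialProd f)) = Ψ := by
  funext x
  rw [homogenize, ← hΨ]
  exact congrArg Ψ (Fin.partialProd_left_inv x)

lemma homogenize_equivariant (π : G →* (X →L[ℝ] X)) (n : ℕ) (φ : (Fin n → G) → X) (g : G)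
    (x : Fin (n + 1) → G) :
    homogenize π n φ (fun i => g * x i) = π g (homogenize π n φ x) := by
  simp [homogenize, mul_assoc]

lemma cochainD_map (π : G →* (X →L[ℝ] X)) (S : X →L[ℝ] X) (hS : ∀ g x, S (π g x) = π g (S x))
    (n : ℕ) (φ : (Fin n → G) → X) (g : Fin (n + 1) → G) :
    cochainD π n (fun f => S (φ f)) g = S (cochainD π n φ g) := by
  simp [cochainD, hS]

lemma sum_conj_eq {M : Type*} [AddCommMonoid M] {F : Subgroup G} {E : Finset G}
    (hE : ∀ f ∈ F, ∀ g ∈ E, f * g * f⁻¹ ∈ E) {f : G} (hf : f ∈ F) (u : G → M) :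
    ∑ g ∈ E, u (f⁻¹ * g * f) = ∑ g ∈ E, u g := by
  refine Finset.sum_bij' (fun g _ => f⁻¹ * g * f) (fun g _ => f * g * f⁻¹) ?_ ?_ ?_ ?_ ?_
  · intro g hg
    simpa using hE f⁻¹ (F.inv_mem hf) g hg
  · exact fun g hg => hE f hf g hg
  · intro g _; group
  · intro g _; group
  · intro g _; rfl

/-- On a cocycle restricted to `F`, the operator `|E| - ∑_{g ∈ E} π(g)` is null-cohomologous
for every finite `E ⊆ G` invariant under conjugation by `F`. -/
lemma exists_cochainD_eq_sum_sub (π : G →* (X →L[ℝ] X)) (F : Subgroup G) (E : Finset G)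
    (hE : ∀ f ∈ F, ∀ g ∈ E, f * g * f⁻¹ ∈ E) (n : ℕ) (φ : (Fin (n + 1) → G) → X)
    (hφ : φ ∈ Zset π (n + 1)) :
    ∃ χ : (Fin n → F) → X, ∀ f : Fin (n + 1) → F,
      cochainD (π.comp F.subtype) n χ f
        = ∑ g ∈ E, (resC F (n + 1) φ f - π g (resC F (n + 1) φ f)) := by
  set Φ := homogenize π (n + 1) φ with hΦ
  have hdΦ : homogD (n + 2) Φ = fun _ => 0 := by
    funext x
    rw [hΦ, homogD_homogenize, show cochainD π (n + 1) φ = 0 from hφ]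
    simp [homogenize]
  let Ψ : (Fin (n + 1) → F) → X := fun x => ∑ g ∈ E, prism g (n + 1) Φ fun i => (x i : G)
  have hΨ (f : F) (x : Fin (n + 1) → F) :
      Ψ (fun i => f * x i) = (π.comp F.subtype) f (Ψ x) := by
    have h (g : G) : prism g (n + 1) Φ (fun i => (f : G) * (x i : G))
        = π f (prism ((f : G)⁻¹ * g * f) (n + 1) Φ fun i => (x i : G)) := by
      rw [prism_translate, ← prism_map]
      simp only [hΦ, homogenize_equivariant]
    simp only [Ψ, Subgroup.coe_mul, h]
    rw [sum_conj_eq hE f.2 (fun g => π f (prism g (n + 1) Φ fun i => (x i : G)))]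
    simp
  refine ⟨fun f => Ψ (Fin.partialProd f), fun f => ?_⟩
  set χ : (Fin n → F) → X := fun f => Ψ (Fin.partialProd f)
  have hχ : homogenize (π.comp F.subtype) n χ = Ψ := homogenize_of_equivariant _ n Ψ hΨ
  have h1 := homogD_homogenize (π.comp F.subtype) n χ (Fin.partialProd f)
  rw [homogenize_partialProd, hχ, homogD_sum] at h1
  rw [← neg_eq_iff_eq_neg] at h1
  rw [← h1, ← Finset.sum_neg_distrib]
  refine Finset.sum_congr rfl fun g _ => ?_
  have h2 := homogD_prism_add_prism_homogD g (n + 1) Φ fun i => ((Fin.partialProd f i : F) : G)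
  rw [hdΦ, prism_zero, add_zero] at h2
  have h3 : Φ (fun i => ((Fin.partialProd f i : F) : G)) = resC F (n + 1) φ f := by
    rw [hΦ, homogenize, resC]
    simp only [← Subgroup.coe_inv, ← Subgroup.coe_mul, Fin.partialProd_right_inv]
    simp
  rw [hΦ, homogenize_equivariant, ← hΦ, h3] at h2
  rw [← neg_sub, ← h2]
  rfl

/-- Failure of almost invariant unit vectors on `FC_G(F)` is witnessed by an `F`-invariant
finite set containing `1`. -/
lemma exists_conj_invariant_finset (π : G →* (X →L[ℝ] X)) (F : Subgroup G)
    (h : ¬ HasAIUVOn π (FCset F)) :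
    ∃ E : Finset G, 1 ∈ E ∧ (∀ f ∈ F, ∀ g ∈ E, f * g * f⁻¹ ∈ E) ∧
      ∃ ε : ℝ, 0 < ε ∧ ∀ x : X, ‖x‖ = 1 → ∃ g ∈ E, ε ≤ ‖x - π g x‖ := by
  simp only [HasAIUVOn] at h
  push Not at h
  obtain ⟨E₀, hE₀, ε, hε, h⟩ := h
  let S : Set G := insert 1 (⋃ g ∈ E₀, {x | ∃ f ∈ F, x = f * g * f⁻¹})
  have hS : S.Finite :=
    (Set.Finite.biUnion E₀.finite_toSet fun g hg => hE₀ hg).insert 1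
  refine ⟨hS.toFinset, ?_, ?_, ε, hε, fun x hx => ?_⟩
  · simp [S]
  · intro f hf g hg
    simp only [Set.Finite.mem_toFinset, S, Set.mem_insert_iff, Set.mem_iUnion,
      Set.mem_ofPred_eq] at hg ⊢
    rcases hg with rfl | ⟨g₀, hg₀, f₀, hf₀, rfl⟩
    · simp
    · exact Or.inr ⟨g₀, hg₀, f * f₀, F.mul_mem hf hf₀, by group⟩
  · obtain ⟨g, hg, hgx⟩ := h x hx
    refine ⟨g, ?_, hgx⟩
    simp only [Set.Finite.mem_toFinset, S, Set.mem_insert_iff, Set.mem_iUnion,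
      Set.mem_ofPred_eq]
    exact Or.inr ⟨g, hg, 1, F.one_mem, by group⟩

/-- In a uniformly convex module the sum of `π(g)` over a set without almost invariant vectors
has norm less than the cardinality, so the difference is invertible. -/
lemma isUnit_card_sub_sum [CompleteSpace X] [UniformConvexSpace X] (π : G →* (X →L[ℝ] X))
    (hiso : ∀ (g : G) (x : X), ‖π g x‖ = ‖x‖) (E : Finset G) (h1 : 1 ∈ E) {ε : ℝ} (hε : 0 < ε)
    (h : ∀ x : X, ‖x‖ = 1 → ∃ g ∈ E, ε ≤ ‖x - π g x‖) :
    IsUnit ((E.card : ℝ) • (1 : X →L[ℝ] X) - ∑ g ∈ E, π g) := by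
  classical
  have hN : 0 < (E.card : ℝ) := by exact_mod_cast Finset.card_pos.2 ⟨1, h1⟩
  obtain ⟨δ, hδ, huc⟩ := exists_forall_sphere_dist_add_le_two_sub X hε
  have hunit (x : X) (hx : ‖x‖ = 1) : ‖∑ g ∈ E, π g x‖ ≤ E.card - δ := by
    obtain ⟨g, hg, hgx⟩ := h x hx
    have hg1 : g ≠ 1 := by
      rintro rfl
      simp at hgx
      linarith
    have hg' : g ∈ E.erase 1 := Finset.mem_erase.2 ⟨hg1, hg⟩
    have hcard : (((E.erase 1).erase g).card : ℝ) + 2 = E.card := by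
      have e1 := Finset.card_erase_add_one h1
      have e2 := Finset.card_erase_add_one hg'
      rw [← e1, ← e2]
      push_cast
      ring
    rw [← Finset.add_sum_erase E _ h1, ← Finset.add_sum_erase _ _ hg', ← add_assoc]
    have h2 : ‖x + π g x‖ ≤ 2 - δ := huc hx (by rw [hiso, hx]) hgx
    have h3 : ‖∑ k ∈ (E.erase 1).erase g, π k x‖ ≤ ((E.erase 1).erase g).card := by
      refine (norm_sum_le _ _).trans ?_
      simp [hiso, hx]
    have h4 := norm_add_le (π 1 x + π g x) (∑ k ∈ (E.erase 1).erase g, π k x)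
    rw [map_one] at h4 ⊢
    rw [one_apply_eq_self] at h4 ⊢
    linarith
  let A : X →L[ℝ] X := (E.card : ℝ)⁻¹ • ∑ g ∈ E, π g
  have hA : ‖A‖ < 1 := by
    have hbound : ‖A‖ ≤ max ((E.card : ℝ)⁻¹ * (E.card - δ)) 0 := by
      refine A.opNorm_le_of_unit_norm (le_max_right _ _) fun x hx => le_max_of_le_left ?_
      simp only [A, smul_apply, sum_apply, norm_smul,
        norm_inv, Real.norm_natCast]
      gcongr
      exact hunit x hx
    refine hbound.trans_lt (max_lt ?_ one_pos)
    rw [inv_mul_lt_one₀ hN]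
    linarith
  have heq : (E.card : ℝ) • (1 : X →L[ℝ] X) - ∑ g ∈ E, π g = (E.card : ℝ) • (1 - A) := by
    rw [smul_sub, smul_inv_smul₀ hN.ne']
  rw [heq]
  exact (isUnit_one_sub_of_norm_lt_one hA).smul (Units.mk0 _ hN.ne')

/-- If `(X,π)` is a uniformly convex isometric Banach `G`-module with no almost
invariant unit vectors as an `FC_G(F)`-module, then for every `n` the restriction map
`Hⁿ(G,X) → Hⁿ(F,X)` is zero: every `n`-cocycle of `G` restricts on `F` to an
`n`-coboundary. -/
theorem restriction_Hn_zero [CompleteSpace X] [UniformConvexSpace X]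
    (π : G →* (X →L[ℝ] X)) (hiso : ∀ (g : G) (x : X), ‖π g x‖ = ‖x‖)
    (F : Subgroup G) (hnaiuv : ¬ HasAIUVOn π (FCset F)) :
    ∀ (n : ℕ) (φ : (Fin n → G) → X), φ ∈ Zset π n →
      resC F n φ ∈ Bset (π.comp F.subtype) n := by
  intro n φ hφ
  obtain ⟨E, h1, hE, ε, hε, hx⟩ := exists_conj_invariant_finset π F hnaiuv
  obtain ⟨T, hT⟩ := isUnit_card_sub_sum π hiso E h1 hε hx
  have hTapply (x : X) : (T : X →L[ℝ] X) x = ∑ g ∈ E, (x - π g x) := by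
    rw [hT]
    simp [Finset.sum_sub_distrib, Nat.cast_smul_eq_nsmul]
  have hinv (x : X) : (↑T⁻¹ : X →L[ℝ] X) ((T : X →L[ℝ] X) x) = x := by
    rw [← mul_apply_eq_comp, Units.inv_mul, one_apply_eq_self]
  cases n with
  | zero =>
    have hfix (g : G) : π g (φ ![]) = φ ![] := by
      have := congrFun (show cochainD π 0 φ = 0 from hφ) (fun _ => g)
      simp only [cochainD, Subsingleton.elim _ (![] : Fin 0 → G)] at this
      simpa [neg_add_eq_zero] using this
    have h0 : φ ![] = 0 := by
      rw [← hinv (φ ![]), hTapply]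
      simp [hfix]
    simp only [Bset, Set.mem_singleton_iff]
    funext f
    rw [resC, Subsingleton.elim (fun i => (f i : G)) ![], h0]
    rfl
  | succ n =>
    obtain ⟨χ, hχ⟩ := exists_cochainD_eq_sum_sub π F E hE n φ hφ
    have hcomm (f : F) : Commute (T : X →L[ℝ] X) (π f) := by
      rw [hT]
      refine ((Commute.one_left _).smul_left _).sub_left ?_
      rw [Commute, SemiconjBy, Finset.sum_mul, Finset.mul_sum,
        ← sum_conj_eq hE f.2 (fun g => π f * π g)]
      refine Finset.sum_congr rfl fun g _ => ?_
      rw [← map_mul, ← map_mul]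
      congr 1
      group
    refine ⟨fun f => (↑T⁻¹ : X →L[ℝ] X) (χ f), ?_⟩
    funext f
    rw [cochainD_map, hχ, ← hTapply, hinv]
    intro g x
    exact DFunLike.congr_fun (hcomm g).units_inv_left.eq x
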